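/- arXiv:2505.19033 — 3 statements merged into one kernel-verified Lean document; each statement's English description precedes it below -/
import Mathlib

section
/- Let π ∈ Δ^K with entries sorted in non-increasing order π_1 ≥ π_2 ≥ … ≥ π_K, let τ ∈ (0,1], let L = min{k : Σ_{j=1}^k π_j ≥ τ}, and assume π_L > 0. Define b ∈ [0,1]^K by b_j = 1 for j < L, b_L = (τ − Σ_{j=1}^{L−1} π_j)/π_L, and b_j = 0 for j > L. Then for every b' ∈ [0,1]^K with b'·π ≥ τ, Σ_k b'_k ≥ Σ_k b_k = L − 1 + (τ − Σ_{j=1}^{L−1} π_j)/π_L. That is, b is an optimal solution of the single-constraint BPS (fractional knapsack) problem, and it coincides in expectation with the Adaptive Prediction Set at threshold τ. -/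
theorem sum_ite_lt_ite_eq {ι M : Type*} [Fintype ι] [LinearOrder ι] [LocallyFiniteOrderBot ι]
    [AddCommMonoid M] (f : ι → M) (c : M) (a : ι) :
    ∑ j, (if j < a then f j else if j = a then c else 0) = ∑ j ∈ Finset.Iio a, f j + c := by
  have hsplit (j : ι) : (if j < a then f j else if j = a then c else 0)
      = (if j < a then f j else 0) + (if j = a then c else 0) := by
    by_cases hlt : j < a
    · simp [hlt, hlt.ne]
    · simp [hlt]
  have hIio : Finset.univ.filter (· < a) = Finset.Iio a := by ext; simp
  simp only [hsplit, Finset.sum_add_distrib, Finset.sum_ite_eq', Finset.mem_univ, if_true,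
    ← Finset.sum_filter, hIio]

/-- Exchange argument for the fractional knapsack problem: a vector that is maximal where the
weight exceeds `t` and minimal where the weight is below `t` has minimal total among all vectors
of at least the same weighted sum. -/
theorem sum_le_sum_of_exchange {ι : Type*} [Fintype ι] (w b b' : ι → ℝ) {t : ℝ} (ht : 0 < t)
    (hexch : ∀ k, (b' k - b k) * (w k - t) ≤ 0)
    (hw : ∑ k, b k * w k ≤ ∑ k, b' k * w k) : ∑ k, b k ≤ ∑ k, b' k := by
  have hsum : ∑ k, (b' k - b k) * (w k - t) ≤ 0 := Finset.sum_nonpos fun k _ => hexch k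
  have hexpand : ∑ k, (b' k - b k) * (w k - t)
      = (∑ k, b' k * w k - ∑ k, b k * w k) - t * (∑ k, b' k - ∑ k, b k) := by
    simp only [← Finset.sum_sub_distrib, Finset.mul_sum]
    exact Finset.sum_congr rfl fun k _ => by ring
  have hmul : 0 ≤ t * (∑ k, b' k - ∑ k, b k) := by linarith
  linarith [nonneg_of_mul_nonneg_right hmul ht]

/-- With `π` sorted non-increasingly, `τ ∈ (0,1]`, `L` the least index whose
cumulative probability reaches `τ` (so the 1-indexed position of `L` is `L.val + 1` and
`L - 1 = L.val`), and `π L > 0`, the APS vector `b` (ones before `L`, the fractional value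
`(τ - ∑_{j<L} π j)/π L` at `L`, zeros after) is optimal for the single-constraint BPS
problem: every `b' ∈ [0,1]^K` with `b' · π ≥ τ` has `∑ₖ b'ₖ ≥ ∑ₖ bₖ`, and
`∑ₖ bₖ = (L - 1) + (τ - ∑_{j<L} π j)/π L` (with `L - 1 = L.val` in 0-indexed form). -/
theorem aps_vector_optimal {K : ℕ} (π : Fin K → ℝ)
    (hπ : π ∈ stdSimplex ℝ (Fin K)) (hsort : Antitone π)
    (τ : ℝ) (hτ : τ ∈ Set.Ioc (0:ℝ) 1)
    (L : Fin K) (hL : IsLeast {l : Fin K | τ ≤ ∑ j ∈ Finset.Iic l, π j} L)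
    (hπL : 0 < π L) :
    (∀ b' : Fin K → ℝ, (∀ k, b' k ∈ Set.Icc (0:ℝ) 1) → τ ≤ ∑ k, b' k * π k →
      ∑ j : Fin K,
          (if j < L then (1:ℝ) else if j = L then (τ - ∑ i ∈ Finset.Iio L, π i) / π L else 0)
        ≤ ∑ k, b' k) ∧
    ∑ j : Fin K,
        (if j < L then (1:ℝ) else if j = L then (τ - ∑ i ∈ Finset.Iio L, π i) / π L else 0)
      = (L.val : ℝ) + (τ - ∑ i ∈ Finset.Iio L, π i) / π L := by
  constructor
  · intro b' hb' hcov
    refine sum_le_sum_of_exchange π _ b' hπL (fun k => ?_) (le_trans (le_of_eq ?_) hcov)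
    · rcases lt_trichotomy k L with hk | rfl | hk
      · simp only [hk, if_true]
        exact mul_nonpos_of_nonpos_of_nonneg (sub_nonpos.2 (hb' k).2) (sub_nonneg.2 (hsort hk.le))
      · simp
      · simp only [hk.not_gt, hk.ne', if_false, sub_zero]
        exact mul_nonpos_of_nonneg_of_nonpos (hb' k).1 (sub_nonpos.2 (hsort hk.le))
    · have hcongr (k : Fin K) :
          (if k < L then (1 : ℝ) else if k = L then (τ - ∑ i ∈ Finset.Iio L, π i) / π L else 0) * π k
            = if k < L then π k else if k = L then τ - ∑ i ∈ Finset.Iio L, π i else 0 := by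
        split_ifs with hlt heq
        · exact one_mul _
        · rw [heq, div_mul_cancel₀ _ hπL.ne']
        · exact zero_mul _
      rw [Finset.sum_congr rfl fun k _ => hcongr k, sum_ite_lt_ite_eq]
      ring
  · rw [sum_ite_lt_ite_eq]
    simp
end

section
/- Let K ≥ 2, let p ∈ ℝ^K satisfy Σ_k p_k = 1, let d > 0, and for each ordered pair i ≠ j in {1,…,K} let p^{i,j} = p + d(e_i − e_j). Then every q ∈ ℝ^K with Σ_k q_k = 1 and |Σ_{k∈A}(p_k − q_k)| ≤ d for all subsets A ⊆ {1,…,K} lies in the convex hull of {p^{i,j} : i ≠ j}. -/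
/-- A convex set containing all points `p + d • (eᵢ - eⱼ)` contains `p + d • (a - b)` for all
probability vectors `a` and `b`. -/
theorem Convex.add_smul_sub_mem_of_single {ι : Type*} [Fintype ι] [DecidableEq ι]
    {s : Set (ι → ℝ)} (hs : Convex ℝ s) {p : ι → ℝ} {d : ℝ}
    (h : ∀ i j, p + d • (Pi.single i (1 : ℝ) - Pi.single j (1 : ℝ)) ∈ s)
    {a b : ι → ℝ} (ha : a ∈ stdSimplex ℝ ι) (hb : b ∈ stdSimplex ℝ ι) :
    p + d • (a - b) ∈ s := by
  have key : ∀ i, p + d • (Pi.single i (1 : ℝ) - b) ∈ s := by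
    intro i
    convert hs.sum_mem (t := Finset.univ) (fun j _ => hb.1 j) hb.2 (fun j _ => h i j) using 1
    ext k
    simp [mul_comm, mul_sub, Finset.sum_add_distrib, Finset.sum_sub_distrib,
      ← Finset.mul_sum, hb.2, Pi.single_apply]
  convert hs.sum_mem (t := Finset.univ) (fun i _ => ha.1 i) ha.2 (fun i _ => key i) using 1
  ext k
  simp [mul_comm, mul_sub, Finset.sum_add_distrib, Finset.sum_sub_distrib,
    ← Finset.mul_sum, ← Finset.sum_mul, ha.2, Pi.single_apply]

/-- The sum of the positive parts of a finite family is the sum over one of its subfamilies. -/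
theorem Finset.sum_max_zero_eq_sum_filter {ι : Type*} (s : Finset ι) (f : ι → ℝ) :
    ∑ k ∈ s, max (f k) 0 = ∑ k ∈ s with 0 < f k, f k := by
  rw [Finset.sum_filter]
  refine Finset.sum_congr rfl fun k _ => ?_
  split_ifs with h
  · exact max_eq_left h.le
  · exact max_eq_right (not_lt.mp h)

/-- Every `q` summing to one with `|∑_{k ∈ A} (p k - q k)| ≤ d` for all
subsets `A` lies in the convex hull of the corner points `p^{i,j} = p + d • (eᵢ - eⱼ)`
(for `i ≠ j`). -/
theorem tv_neighborhood_subset_corners_hull {K : ℕ} (hK : 2 ≤ K)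
    (p : Fin K → ℝ) (hp : ∑ k, p k = 1) (d : ℝ) (hd : 0 < d)
    (q : Fin K → ℝ) (hq1 : ∑ k, q k = 1)
    (hq2 : ∀ A : Finset (Fin K), |∑ k ∈ A, (p k - q k)| ≤ d) :
    q ∈ convexHull ℝ {x : Fin K → ℝ |
      ∃ i j : Fin K, i ≠ j ∧ x = p + d • (Pi.single i (1:ℝ) - Pi.single j (1:ℝ))} := by
  set S := {x : Fin K → ℝ |
      ∃ i j : Fin K, i ≠ j ∧ x = p + d • (Pi.single i (1:ℝ) - Pi.single j (1:ℝ))}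
  have hconv := convex_convexHull ℝ S
  have hne : ∀ i j, i ≠ j →
      p + d • (Pi.single i (1 : ℝ) - Pi.single j (1 : ℝ)) ∈ convexHull ℝ S :=
    fun i j hij => subset_convexHull ℝ S ⟨i, j, hij, rfl⟩
  let z : Fin K := ⟨0, by lia⟩
  let o : Fin K := ⟨1, by lia⟩
  have hzo : z ≠ o := by simp [z, o]
  have hpS : p ∈ convexHull ℝ S := by
    convert hconv (hne z o hzo) (hne o z hzo.symm) (by norm_num : (0 : ℝ) ≤ 1 / 2)
      (by norm_num : (0 : ℝ) ≤ 1 / 2) (by norm_num) using 1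
    module
  have hall : ∀ i j,
      p + d • (Pi.single i (1 : ℝ) - Pi.single j (1 : ℝ)) ∈ convexHull ℝ S := by
    intro i j
    by_cases hij : i = j
    · simpa [hij] using hpS
    · exact hne i j hij
  set c := ∑ k, max (p k - q k) 0 with hc
  have hcd : c ≤ d := by
    rw [hc, Finset.sum_max_zero_eq_sum_filter]
    exact (le_abs_self _).trans (hq2 _)
  have hmax : ∀ k, max (q k - p k) 0 = max (p k - q k) 0 + (q k - p k) := by
    intro k
    grind
  have hc' : ∑ k, max (q k - p k) 0 = c := by
    simp [hmax, Finset.sum_add_distrib, hp, hq1, hc]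
  have hsimplex : ∀ f : Fin K → ℝ, ∑ k, max (f k) 0 = c →
      (fun k => max (f k) 0 / d + (Pi.single z (1 - c / d) : Fin K → ℝ) k) ∈ stdSimplex ℝ (Fin K) := by
    intro f hf
    refine ⟨fun k => add_nonneg (by positivity) ?_, ?_⟩
    · have : 0 ≤ 1 - c / d := sub_nonneg.mpr ((div_le_one hd).mpr hcd)
      have hz : (0 : Fin K → ℝ) ≤ Pi.single z (1 - c / d) := Pi.single_nonneg.mpr this
      exact hz k
    · rw [Finset.sum_add_distrib, ← Finset.sum_div, hf]
      simp
  convert hconv.add_smul_sub_mem_of_single hall (hsimplex (fun k => q k - p k) hc')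
    (hsimplex (fun k => p k - q k) rfl) using 1
  ext k
  simp only [Pi.add_apply, Pi.smul_apply, Pi.sub_apply, smul_eq_mul, hmax]
  field_simp
  ring
end

section
/- Let π^(1),…,π^(m) ∈ ℝ^K, c ∈ ℝ, and let P = {b ∈ [0,1]^K : b·π^(j) ≥ c for all j ∈ {1,…,m}}. Then every extreme point of the polytope P has at most m coordinates lying strictly in the open interval (0,1). Consequently, the BPS linear program (minimizing Σ_k b_k over P) admits an optimal solution with at most min(K, m) randomized (fractional) entries. -/
/-- A nonzero direction supported on a finite set of more than `m` indices and annihilated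
by `m` linear functionals. -/
lemma exists_ne_zero_supported_of_lt_ncard {ι : Type*} [Fintype ι] {m : ℕ}
    (π : Fin m → ι → ℝ) (s : Set ι) (h : m < s.ncard) :
    ∃ d : ι → ℝ, d ≠ 0 ∧ (∀ k, k ∉ s → d k = 0) ∧ ∀ j, ∑ k, d k * π j k = 0 := by
  classical
  let f : (s → ℝ) →ₗ[ℝ] (ι → ℝ) := Function.ExtendByZero.linearMap ℝ ((↑) : s → ι)
  let g : (ι → ℝ) →ₗ[ℝ] (Fin m → ℝ) := (Matrix.of π).mulVecLin
  have hlt : Module.finrank ℝ (Fin m → ℝ) < Module.finrank ℝ (s → ℝ) := by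
    rw [Module.finrank_fin_fun, Module.finrank_fintype_fun_eq_card, ← Nat.card_eq_fintype_card]
    exact h
  obtain ⟨v, hv, hv0⟩ := (Submodule.ne_bot_iff _).1
    (LinearMap.ker_ne_bot_of_finrank_lt (f := g ∘ₗ f) hlt)
  refine ⟨f v, fun h0 => hv0 ?_, fun k hk => ?_, fun j => ?_⟩
  · ext k
    have := congrFun h0 k
    simpa [f, Subtype.val_injective.extend_apply] using this
  · exact Function.extend_apply' _ _ _ (by rintro ⟨a, rfl⟩; exact hk a.2)
  · have := congrFun (LinearMap.mem_ker.1 hv) j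
    simpa [g, Matrix.mulVec, dotProduct, mul_comm] using this

/-- An extreme point of the unit cube cut by `m` half-spaces has at most `m` fractional
coordinates. -/
lemma ncard_fractional_le_of_mem_extremePoints {ι : Type*} [Fintype ι] {m : ℕ}
    (π : Fin m → ι → ℝ) (c : ℝ) {b : ι → ℝ}
    (hb : b ∈ Set.extremePoints ℝ
      {b : ι → ℝ | (∀ k, b k ∈ Set.Icc (0:ℝ) 1) ∧ ∀ j, c ≤ ∑ k, b k * π j k}) :
    {k : ι | 0 < b k ∧ b k < 1}.ncard ≤ m := by
  by_contra! hlt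
  obtain ⟨d, hd0, hds, hdπ⟩ := exists_ne_zero_supported_of_lt_ncard π _ hlt
  obtain ⟨⟨hb01, hbc⟩, hext⟩ := hb
  have hcube : ∀ᶠ t : ℝ in nhds 0, ∀ k, b k + t * d k ∈ Set.Icc (0:ℝ) 1 := by
    refine Filter.eventually_all.2 fun k => ?_
    by_cases hk : 0 < b k ∧ b k < 1
    · have hcont : Continuous fun t : ℝ => b k + t * d k := by fun_prop
      exact hcont.continuousAt.eventually_mem (Icc_mem_nhds (by simpa using hk.1)
        (by simpa using hk.2))
    · simp only [hds k hk, mul_zero, add_zero]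
      exact Filter.Eventually.of_forall fun _ => hb01 k
  obtain ⟨ε, hε, hball⟩ := Metric.eventually_nhds_iff.1 hcube
  have hmem : ∀ t : ℝ, |t| < ε → b + t • d ∈
      {b : ι → ℝ | (∀ k, b k ∈ Set.Icc (0:ℝ) 1) ∧ ∀ j, c ≤ ∑ k, b k * π j k} := by
    refine fun t ht => ⟨hball (by simpa using ht), fun j => ?_⟩
    have : ∑ k, (b + t • d) k * π j k = ∑ k, b k * π j k + t * ∑ k, d k * π j k := by
      rw [Finset.mul_sum, ← Finset.sum_add_distrib]
      exact Finset.sum_congr rfl fun k _ => by simp; ring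
    rw [this, hdπ j, mul_zero, add_zero]
    exact hbc j
  have hhalf : |ε / 2| < ε := by rw [abs_of_pos (by positivity)]; linarith
  have heq := hext (hmem (ε / 2) hhalf) (hmem (-(ε / 2)) (by rwa [abs_neg]))
    ⟨1 / 2, 1 / 2, by norm_num, by norm_num, by norm_num, by ext k; simp; ring⟩
  have : (ε / 2) • d = 0 := by simpa using heq
  exact hd0 ((smul_eq_zero.1 this).resolve_left (by positivity))

/-- The unit cube cut by closed half-spaces is compact. -/
lemma isCompact_cube_inter_halfSpaces {ι κ : Type*} [Fintype ι] (π : κ → ι → ℝ) (c : ℝ) :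
    IsCompact {b : ι → ℝ | (∀ k, b k ∈ Set.Icc (0:ℝ) 1) ∧ ∀ j, c ≤ ∑ k, b k * π j k} := by
  have hcube : IsCompact {b : ι → ℝ | ∀ k, b k ∈ Set.Icc (0:ℝ) 1} :=
    isCompact_pi_infinite fun _ => isCompact_Icc
  refine hcube.inter_right (t := {b : ι → ℝ | ∀ j, c ≤ ∑ k, b k * π j k}) ?_
  simp only [Set.ofPred_forall]
  exact isClosed_iInter fun j => isClosed_le continuous_const (by fun_prop)

/-- A continuous linear functional attains its maximum over a nonempty compact set at an
extreme point. -/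
lemma IsCompact.exists_mem_extremePoints_forall_le {E : Type*} [AddCommGroup E] [Module ℝ E]
    [TopologicalSpace E] [T2Space E] [IsTopologicalAddGroup E] [ContinuousSMul ℝ E]
    [LocallyConvexSpace ℝ E] {s : Set E} (hs : IsCompact s) (hne : s.Nonempty)
    (l : StrongDual ℝ E) : ∃ x ∈ s.extremePoints ℝ, ∀ y ∈ s, l y ≤ l x := by
  have hexp : IsExposed ℝ s (l.toExposed s) := ContinuousLinearMap.toExposed.isExposed
  obtain ⟨x₀, hx₀, hmax⟩ := hs.exists_isMaxOn hne l.continuous.continuousOn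
  obtain ⟨x, hx⟩ := (hexp.isCompact hs).extremePoints_nonempty ⟨x₀, hx₀, hmax⟩
  exact ⟨x, hexp.isExtreme.extremePoints_subset_extremePoints hx, hx.1.2⟩

/-- Every extreme point of the polytope
`P = {b ∈ [0,1]^K : b · π⁽ʲ⁾ ≥ c for all j}` has at most `m` coordinates strictly inside
`(0,1)`; consequently (when `P` is nonempty) the BPS linear program admits an optimal
solution with at most `min(K, m)` randomized (fractional) entries. -/
theorem bps_extreme_points_few_fractional {K m : ℕ} (π : Fin m → Fin K → ℝ) (c : ℝ) :
    (∀ b ∈ Set.extremePoints ℝ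
        {b : Fin K → ℝ | (∀ k, b k ∈ Set.Icc (0:ℝ) 1) ∧ ∀ j, c ≤ ∑ k, b k * π j k},
      {k : Fin K | 0 < b k ∧ b k < 1}.ncard ≤ m) ∧
    ({b : Fin K → ℝ | (∀ k, b k ∈ Set.Icc (0:ℝ) 1) ∧
        ∀ j, c ≤ ∑ k, b k * π j k}.Nonempty →
      ∃ b ∈ {b : Fin K → ℝ | (∀ k, b k ∈ Set.Icc (0:ℝ) 1) ∧ ∀ j, c ≤ ∑ k, b k * π j k},
        (∀ b' ∈ {b : Fin K → ℝ | (∀ k, b k ∈ Set.Icc (0:ℝ) 1) ∧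
            ∀ j, c ≤ ∑ k, b k * π j k}, ∑ k, b k ≤ ∑ k, b' k) ∧
        {k : Fin K | 0 < b k ∧ b k < 1}.ncard ≤ min K m) := by
  refine ⟨fun b hb => ncard_fractional_le_of_mem_extremePoints π c hb, fun hne => ?_⟩
  obtain ⟨b, hb, hmax⟩ := (isCompact_cube_inter_halfSpaces π c).exists_mem_extremePoints_forall_le
    hne (-∑ k, ContinuousLinearMap.proj (R := ℝ) (φ := fun _ : Fin K => ℝ) k)
  refine ⟨b, hb.1, fun b' hb' => by simpa using hmax b' hb', le_min ?_ ?_⟩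
  · simpa using Set.ncard_le_card {k : Fin K | 0 < b k ∧ b k < 1}
  · exact ncard_fractional_le_of_mem_extremePoints π c hb
end
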